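/- arXiv:1907.04153 — 3 statements merged into one kernel-verified Lean document; each statement's English description precedes it below -/
import Mathlib

section
/- For every positive integer n and every minimal homeomorphism (X, φ) of a Cantor set X, there exists a compact metric space X̃, a minimal homeomorphism φ̃ : X̃ → X̃, and a factor map π : (X̃, φ̃) → (X, φ) such that for each x ∈ X the fiber π⁻¹{x} is either a single point or homeomorphic to the n-cube [0,1]ⁿ, and both possibilities occur. -/
open Set Filter Topology

namespace CantorExtension

variable {X C : Type}

/-- A sequence all of whose tails are dense. -/
theorem exists_seq_tails_dense (C : Type) [TopologicalSpace C]
    [TopologicalSpace.SeparableSpace C] [Nonempty C] :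
    ∃ q : ℕ → C, ∀ V : Set C, IsOpen V → V.Nonempty → ∀ N, ∃ k, N ≤ k ∧ q k ∈ V := by
  refine ⟨fun k => TopologicalSpace.denseSeq C k.unpair.1, fun V hV hne N => ?_⟩
  obtain ⟨j, hj⟩ := (TopologicalSpace.denseRange_denseSeq C).exists_mem_open hV hne
  exact ⟨Nat.pair j N, Nat.right_le_pair j N, by simpa using hj⟩

/-- A strictly decreasing sequence of clopen neighbourhoods shrinking to a non-isolated point. -/
theorem exists_clopen_seq [MetricSpace X] [CompactSpace X] [TotallyDisconnectedSpace X]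
    [PerfectSpace X] (a : X) :
    ∃ W : ℕ → Set X, (∀ k, IsClopen (W k)) ∧ (∀ k, a ∈ W k) ∧
      (∀ k, W (k + 1) ⊂ W k) ∧ ∀ U ∈ 𝓝 a, ∃ k, W k ⊆ U := by
  have step : ∀ (k : ℕ) (U : {U : Set X // IsClopen U ∧ a ∈ U}),
      ∃ V : {U : Set X // IsClopen U ∧ a ∈ U},
        V.1 ⊂ U.1 ∧ V.1 ⊆ Metric.ball a (1 / ((k : ℝ) + 1)) := by
    rintro k ⟨U, hU, haU⟩
    obtain ⟨z, hzU, hza⟩ : ∃ z ∈ U, z ≠ a := by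
      have hd : Dense ({a}ᶜ : Set X) := dense_compl_singleton a
      obtain ⟨z, hz, hz'⟩ := hd.inter_open_nonempty U hU.isOpen ⟨a, haU⟩
      exact ⟨z, hz, hz'⟩
    obtain ⟨V, hV, haV, hVs⟩ := compact_exists_isClopen_in_isOpen
      ((hU.isOpen.inter (Metric.isOpen_ball (x := a) (ε := 1 / ((k : ℝ) + 1)))).inter
        (isOpen_compl_singleton (x := z)))
      (show a ∈ _ from ⟨⟨haU, Metric.mem_ball_self (by positivity)⟩, fun h => hza h.symm⟩)
    refine ⟨⟨V, hV, haV⟩, ⟨fun x hx => (hVs hx).1.1, fun h => (hVs (h hzU)).2 rfl⟩,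
      fun x hx => (hVs hx).1.2⟩
  choose S hS₁ hS₂ using step
  let W : ℕ → {U : Set X // IsClopen U ∧ a ∈ U} :=
    fun k => Nat.rec ⟨univ, isClopen_univ, mem_univ a⟩ S k
  refine ⟨fun k => (W k).1, fun k => (W k).2.1, fun k => (W k).2.2, fun k => hS₁ k (W k), ?_⟩
  intro U hU
  obtain ⟨ε, hε, hεU⟩ := Metric.mem_nhds_iff.1 hU
  obtain ⟨k, hk⟩ := exists_nat_one_div_lt hε
  exact ⟨k + 1, (hS₂ k (W k)).trans ((Metric.ball_subset_ball hk.le).trans hεU)⟩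

/-- A function continuous off `a` that takes values in every nonempty open set on
nonempty open sets arbitrarily close to `a`. -/
theorem exists_oscillating [MetricSpace X] [CompactSpace X] [TotallyDisconnectedSpace X]
    [PerfectSpace X] [TopologicalSpace C] [TopologicalSpace.SeparableSpace C] [Nonempty C]
    (a : X) :
    ∃ f : X → C, (∀ x, x ≠ a → ContinuousAt f x) ∧
      ∀ V : Set C, IsOpen V → V.Nonempty → ∀ U ∈ 𝓝 a,
        ∃ A : Set X, IsOpen A ∧ A.Nonempty ∧ A ⊆ U ∧ ∀ x ∈ A, f x ∈ V := by
  classical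
  obtain ⟨q, hq⟩ := exists_seq_tails_dense C
  obtain ⟨W, hW, haW, hss, hsmall⟩ := exists_clopen_seq a
  have hanti : Antitone W := antitone_nat_of_succ_le fun k => (hss k).subset
  have hlevel : ∀ k x, x ∈ W k → x ∉ W (k + 1) → sInf {j | x ∉ W j} = k + 1 := by
    intro k x hx hx'
    refine le_antisymm (Nat.sInf_le hx') (le_csInf ⟨_, hx'⟩ fun j hj => ?_)
    by_contra! hlt
    exact hj (hanti (Nat.lt_succ_iff.1 hlt) hx)
  refine ⟨fun x => q (sInf {j | x ∉ W j}), fun x hx => ?_, fun V hV hne U hU => ?_⟩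
  · obtain ⟨k, hk⟩ := hsmall _ (isOpen_compl_singleton.mem_nhds (fun h : a = x => hx h.symm))
    have hmem : sInf {j | x ∉ W j} ∈ {j | x ∉ W j} := Nat.sInf_mem ⟨k, fun h => hk h rfl⟩
    refine (continuousAt_const (y := q (sInf {j | x ∉ W j}))).congr ?_
    rcases hm : sInf {j | x ∉ W j} with _ | m
    · rw [hm] at hmem
      filter_upwards [(hW 0).compl.isOpen.mem_nhds hmem] with y hy
      rw [Nat.sInf_eq_zero.2 (Or.inl hy)]
    · rw [hm] at hmem
      have hxm : x ∈ W m := by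
        by_contra h
        have : sInf {j | x ∉ W j} ≤ m := Nat.sInf_le h
        omega
      filter_upwards [(hW (m + 1)).compl.isOpen.mem_nhds hmem, (hW m).isOpen.mem_nhds hxm]
        with y hy hy'
      rw [hlevel m y hy' hy]
  · obtain ⟨N, hN⟩ := hsmall U hU
    obtain ⟨k, hk, hqk⟩ := hq V hV hne (N + 1)
    obtain ⟨m, rfl⟩ : ∃ m, k = m + 1 := ⟨k - 1, by omega⟩
    refine ⟨W m \ W (m + 1), (hW m).isOpen.sdiff (hW (m + 1)).isClosed, ?_, ?_, ?_⟩
    · exact nonempty_of_ssubset (hss m)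
    · exact sdiff_subset.trans ((hanti (by omega)).trans hN)
    · rintro x ⟨hx, hx'⟩
      simpa only [hlevel m x hx hx'] using hqk

theorem continuous_zpow [TopologicalSpace X] (φ : X ≃ₜ X) (k : ℤ) :
    Continuous fun x => (φ.toEquiv ^ k) x := by
  have key : ∀ k : ℤ, φ.toEquiv ^ k = (φ ^ k).toEquiv := by
    intro k
    exact (map_zpow (⟨⟨Homeomorph.toEquiv, rfl⟩, fun _ _ => rfl⟩ : (X ≃ₜ X) →* Equiv.Perm X) φ k).symm
  rw [key]
  exact (φ ^ k).continuous

theorem isOpenMap_zpow [TopologicalSpace X] (φ : X ≃ₜ X) (k : ℤ) :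
    IsOpenMap fun x => (φ.toEquiv ^ k) x :=
  IsOpenMap.of_inverse (f' := fun x => (φ.toEquiv ^ (-k)) x) (continuous_zpow φ (-k))
    (fun x => by simp [zpow_neg]) (fun x => by simp [zpow_neg])

/-- A permutation of an infinite `T₁` space with a dense orbit has no periodic point in it. -/
theorem zpow_apply_injective [TopologicalSpace X] [T1Space X] [Infinite X] (σ : Equiv.Perm X)
    (a : X) (h : Dense (range fun k : ℤ => (σ ^ k) a)) :
    Function.Injective fun k : ℤ => (σ ^ k) a := by
  intro i j hij
  by_contra hne
  have hper : (σ ^ (i - j)) a = a := by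
    rw [sub_eq_neg_add, zpow_add, Equiv.Perm.mul_apply, zpow_neg, Equiv.Perm.inv_eq_iff_eq]
    exact hij
  set d := i - j with hd
  have hd0 : d ≠ 0 := sub_ne_zero.2 hne
  have hfin : (range fun k : ℤ => (σ ^ k) a).Finite := by
    refine ((finite_Ico (0 : ℤ) |d|).image fun k : ℤ => (σ ^ k) a).subset ?_
    rintro _ ⟨k, rfl⟩
    refine ⟨k % d, ⟨Int.emod_nonneg k hd0, Int.emod_lt_abs k hd0⟩, ?_⟩
    have hfix : ((σ ^ d) ^ (k / d)) a = a :=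
      Equiv.Perm.zpow_apply_eq_self_of_apply_eq_self hper _
    conv_rhs => rw [← Int.emod_add_mul_ediv k d]
    simp only [zpow_add, zpow_mul, Equiv.Perm.mul_apply, hfix]
  have huniv : (range fun k : ℤ => (σ ^ k) a) = univ := by
    rw [← hfin.isClosed.closure_eq, h.closure_eq]
  exact infinite_univ (huniv ▸ hfin)

/-- Pairs of a point `x` and a sequence that agrees with `f` along the orbit of `x`, except
possibly when the orbit passes through `a`. -/
def Ext (φ : Equiv.Perm X) (a : X) (f : X → C) : Type :=
  {p : X × (ℤ → C) // ∀ k : ℤ, (φ ^ k) p.1 ≠ a → p.2 k = f ((φ ^ k) p.1)}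

namespace Ext

variable {φ : Equiv.Perm X} {a : X} {f : X → C}

instance [TopologicalSpace X] [TopologicalSpace C] : TopologicalSpace (Ext φ a f) :=
  instTopologicalSpaceSubtype

instance [TopologicalSpace X] [TopologicalSpace C] [T3Space X] [T3Space C]
    [SecondCountableTopology X] [SecondCountableTopology C] : TopologicalSpace.MetrizableSpace (Ext φ a f) :=
  have : TopologicalSpace.MetrizableSpace (X × (ℤ → C)) :=
    TopologicalSpace.metrizableSpace_of_t3_secondCountable _
  IsEmbedding.subtypeVal.metrizableSpace

/-- The base point. -/
def proj (y : Ext φ a f) : X := y.1.1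

/-- The sequence coordinate. -/
def seq (y : Ext φ a f) : ℤ → C := y.1.2

theorem ext' {y z : Ext φ a f} (h₁ : y.proj = z.proj) (h₂ : y.seq = z.seq) : y = z :=
  Subtype.ext (Prod.ext h₁ h₂)

theorem seq_eq (y : Ext φ a f) {k : ℤ} (h : (φ ^ k) y.proj ≠ a) :
    y.seq k = f ((φ ^ k) y.proj) := y.2 k h

/-- The section following `f` everywhere. -/
def sec (x : X) : Ext φ a f := ⟨(x, fun k => f ((φ ^ k) x)), fun _ _ => rfl⟩

/-- The lifted permutation: the base map together with the shift. -/
def lift : Equiv.Perm (Ext φ a f) where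
  toFun y := ⟨(φ y.proj, fun k => y.seq (k + 1)), fun k hk => by
    have e : (φ ^ k) (φ y.proj) = (φ ^ (k + 1)) y.proj := by
      rw [zpow_add_one, Equiv.Perm.mul_apply]
    change (φ ^ k) (φ y.proj) ≠ a at hk
    change y.seq (k + 1) = f ((φ ^ k) (φ y.proj))
    rw [e] at hk ⊢
    exact y.seq_eq hk⟩
  invFun y := ⟨(φ.symm y.proj, fun k => y.seq (k - 1)), fun k hk => by
    have e : (φ ^ k) (φ.symm y.proj) = (φ ^ (k - 1)) y.proj := by
      rw [zpow_sub_one, Equiv.Perm.mul_apply]; rfl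
    change (φ ^ k) (φ.symm y.proj) ≠ a at hk
    change y.seq (k - 1) = f ((φ ^ k) (φ.symm y.proj))
    rw [e] at hk ⊢
    exact y.seq_eq hk⟩
  left_inv y := ext' (φ.symm_apply_apply y.proj) (funext fun k => congrArg y.seq (by simp))
  right_inv y := ext' (φ.apply_symm_apply y.proj) (funext fun k => congrArg y.seq (by simp))

theorem proj_lift (y : Ext φ a f) : (lift y).proj = φ y.proj := rfl

theorem proj_lift_zpow (y : Ext φ a f) (k : ℤ) : ((lift ^ k) y).proj = (φ ^ k) y.proj := by
  induction k generalizing y with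
  | zero => rfl
  | succ k ih => rw [zpow_add_one, zpow_add_one]; exact ih (lift y)
  | pred k ih => rw [zpow_sub_one, zpow_sub_one]; exact ih (lift.symm y)

theorem preimage_proj_of_forall_ne {x : X} (hx : ∀ k : ℤ, (φ ^ k) x ≠ a) :
    (proj : Ext φ a f → X) ⁻¹' {x} = {sec x} := by
  ext y
  constructor
  · rintro rfl
    exact ext' rfl (funext fun k => y.seq_eq (hx k))
  · rintro rfl
    rfl

section Topology

variable [TopologicalSpace X] [TopologicalSpace C]

theorem continuous_proj : Continuous (proj : Ext φ a f → X) :=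
  continuous_fst.comp continuous_subtype_val

theorem continuous_seq : Continuous (seq : Ext φ a f → ℤ → C) :=
  continuous_snd.comp continuous_subtype_val

theorem isInducing_prod : IsInducing fun y : Ext φ a f => (y.proj, y.seq) :=
  IsInducing.subtypeVal

theorem continuous_lift (hφ : Continuous φ) : Continuous (lift : Ext φ a f → Ext φ a f) :=
  isInducing_prod.continuous_iff.2 <| (hφ.comp continuous_proj).prodMk <|
    continuous_pi fun k => (continuous_apply (k + 1)).comp continuous_seq

theorem continuous_lift_symm (hφ : Continuous φ.symm) :
    Continuous (lift.symm : Ext φ a f → Ext φ a f) :=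
  isInducing_prod.continuous_iff.2 <| (hφ.comp continuous_proj).prodMk <|
    continuous_pi fun k => (continuous_apply (k - 1)).comp continuous_seq

theorem compactSpace [CompactSpace X] [CompactSpace C] [T1Space X] [T2Space C]
    (hφ : ∀ k : ℤ, Continuous fun x => (φ ^ k) x) (hf : ∀ x, x ≠ a → ContinuousAt f x) :
    CompactSpace (Ext φ a f) := by
  refine isCompact_iff_compactSpace.1 (IsClosed.isCompact ?_)
  refine isClosed_iff_frequently.2 ?_
  intro p hp k hk
  replace hp := hp.mono fun q hq => hq k
  have hcont : Tendsto (fun q : X × (ℤ → C) => (q.2 k, f ((φ ^ k) q.1))) (𝓝 p)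
      (𝓝 (p.2 k, f ((φ ^ k) p.1))) := by
    refine ContinuousAt.prodMk (by fun_prop) ?_
    exact ContinuousAt.comp (f := fun q : X × (ℤ → C) => (φ ^ k) q.1) (hf _ hk)
      ((hφ k).comp continuous_fst).continuousAt
  have hopen : ∀ᶠ q : X × (ℤ → C) in 𝓝 p, (φ ^ k) q.1 ≠ a :=
    ((hφ k).comp continuous_fst).continuousAt.eventually_ne hk
  by_contra hne
  have : ∀ᶠ q : X × (ℤ → C) in 𝓝 p, q.2 k ≠ f ((φ ^ k) q.1) :=
    hcont.eventually (isClosed_diagonal.isOpen_compl.mem_nhds hne)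
  exact hp ((hopen.and this).mono fun q hq h => hq.2 (h hq.1))

/-- The fibre over a point whose orbit passes through `a` exactly once. -/
def fiberHomeomorph (x : X) (m : ℤ) (hx : ∀ k : ℤ, (φ ^ k) x = a ↔ k = m) :
    ((proj : Ext φ a f → X) ⁻¹' {x}) ≃ₜ C where
  toFun y := y.1.seq m
  invFun c := ⟨⟨(x, Function.update (fun k => f ((φ ^ k) x)) m c), fun k hk =>
    Function.update_of_ne (fun h => hk ((hx k).2 h)) c fun k => f ((φ ^ k) x)⟩, rfl⟩
  left_inv := by
    rintro ⟨y, rfl⟩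
    refine Subtype.ext (ext' rfl (funext fun k => ?_))
    change Function.update (fun k => f ((φ ^ k) y.proj)) m (y.seq m) k = y.seq k
    by_cases hk : k = m
    · subst hk; simp
    · rw [Function.update_of_ne hk, y.seq_eq (mt (hx k).1 hk)]
  right_inv c := Function.update_self m c fun k => f ((φ ^ k) x)
  continuous_toFun := (continuous_apply m).comp (continuous_seq.comp continuous_subtype_val)
  continuous_invFun := by
    refine Continuous.subtype_mk (isInducing_prod.continuous_iff.2 ?_) _
    exact continuous_const.prodMk (continuous_const.update m continuous_id)

/-- The points lying over orbits that avoid `a` are dense. -/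
theorem dense_avoiding (hφ : ∀ k : ℤ, Continuous fun x => (φ ^ k) x)
    (hinj : Function.Injective fun k : ℤ => (φ ^ k) a)
    (hD : Dense {x : X | ∀ k : ℤ, (φ ^ k) x ≠ a}) (hf : ∀ x, x ≠ a → ContinuousAt f x)
    (hosc : ∀ V : Set C, IsOpen V → V.Nonempty → ∀ U ∈ 𝓝 a,
      ∃ A : Set X, IsOpen A ∧ A.Nonempty ∧ A ⊆ U ∧ ∀ x ∈ A, f x ∈ V) :
    Dense {y : Ext φ a f | ∀ k : ℤ, (φ ^ k) y.proj ≠ a} := by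
  classical
  rw [dense_iff_inter_open]
  rintro O hO ⟨y, hy⟩
  by_cases hav : ∀ k : ℤ, (φ ^ k) y.proj ≠ a
  · exact ⟨y, hy, hav⟩
  push Not at hav
  obtain ⟨m, hm⟩ := hav
  have hne : ∀ k, k ≠ m → (φ ^ k) y.proj ≠ a := by
    intro k hk h
    have hya : y.proj = (φ ^ (-m)) a := by rw [zpow_neg, Equiv.Perm.eq_inv_iff_eq, hm]
    rw [hya, ← Equiv.Perm.mul_apply, ← zpow_add] at h
    have := @hinj (k + -m) 0 h
    omega
  obtain ⟨O', hO', rfl⟩ := isInducing_prod.isOpen_iff.1 hO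
  let h : X × C → X × (ℤ → C) := fun p =>
    (p.1, Function.update (fun k => f ((φ ^ k) p.1)) m p.2)
  have hh : h (y.proj, y.seq m) = (y.proj, y.seq) := by
    refine Prod.ext rfl (funext fun k => ?_)
    change Function.update (fun k => f ((φ ^ k) y.proj)) m (y.seq m) k = y.seq k
    by_cases hk : k = m
    · subst hk; simp
    · rw [Function.update_of_ne hk, y.seq_eq (hne k hk)]
  have hcont : ContinuousAt h (y.proj, y.seq m) := by
    refine continuousAt_fst.prodMk (continuousAt_pi.2 fun k => ?_)
    by_cases hk : k = m
    · subst hk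
      simpa using continuousAt_snd
    · simp only [Function.update_of_ne hk]
      exact ContinuousAt.comp (f := fun q : X × C => (φ ^ k) q.1) (hf _ (hne k hk))
        ((hφ k).comp continuous_fst).continuousAt
  have hnhds : h ⁻¹' O' ∈ 𝓝 (y.proj, y.seq m) :=
    hcont (by rw [hh]; exact hO'.mem_nhds hy)
  obtain ⟨U, V, hU, hyU, hV, hyV, hUV⟩ := mem_nhds_prod_iff'.1 hnhds
  have hyU' : (fun x => (φ ^ (-m)) x) ⁻¹' U ∈ 𝓝 a := by
    refine (hU.preimage (hφ (-m))).mem_nhds ?_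
    rw [mem_preimage, ← hm, ← Equiv.Perm.mul_apply, ← zpow_add, neg_add_cancel]
    exact hyU
  obtain ⟨A, hA, ⟨z, hz⟩, hAU, hAV⟩ := hosc V hV ⟨_, hyV⟩ _ hyU'
  obtain ⟨x, hxA, hx⟩ := hD.inter_open_nonempty _ (hA.preimage (hφ m))
    ⟨(φ ^ (-m)) z, by simpa [zpow_neg] using hz⟩
  refine ⟨sec x, ?_, hx⟩
  have hxU : x ∈ U := by simpa [zpow_neg] using hAU hxA
  have := hUV (show (x, f ((φ ^ m) x)) ∈ U ×ˢ V from ⟨hxU, hAV _ hxA⟩)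
  have hs : h (x, f ((φ ^ m) x)) = ((sec x : Ext φ a f).proj, (sec x : Ext φ a f).seq) :=
    Prod.ext rfl (Function.update_eq_self m _)
  rwa [mem_preimage, hs] at this

/-- Density of all orbits lifts to the extension. -/
theorem dense_orbit [CompactSpace (Ext φ a f)] [T2Space X]
    (hmin : ∀ x : X, Dense (range fun k : ℤ => (φ ^ k) x))
    (hdense : Dense {y : Ext φ a f | ∀ k : ℤ, (φ ^ k) y.proj ≠ a}) (y : Ext φ a f) :
    Dense (range fun k : ℤ => (lift ^ k) y) := by
  refine dense_iff_inter_open.2 fun O hO hne => ?_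
  obtain ⟨p, hpO, hp⟩ := hdense.inter_open_nonempty O hO hne
  set Z := closure (range fun k : ℤ => (lift ^ k) y) with hZ
  have hclosed : IsClosed (proj '' Z) :=
    (isClosed_closure.isCompact.image continuous_proj).isClosed
  have hsub : (range fun k : ℤ => (φ ^ k) y.proj) ⊆ proj '' Z := by
    rintro _ ⟨k, rfl⟩
    exact ⟨(lift ^ k) y, subset_closure ⟨k, rfl⟩, proj_lift_zpow y k⟩
  obtain ⟨z, hzZ, hzp⟩ : p.proj ∈ proj '' Z :=
    closure_minimal hsub hclosed (hmin y.proj p.proj)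
  have hfib := preimage_proj_of_forall_ne (f := f) hp
  have hz : z = sec p.proj := hfib.subset hzp
  have hp' : p = sec p.proj := hfib.subset (rfl : p.proj = p.proj)
  rw [hz, ← hp'] at hzZ
  exact mem_closure_iff.1 hzZ O hO hpO

end Topology

end Ext

end CantorExtension


/-- **Cube-fiber extensions of Cantor minimal systems.**
For every positive integer `n` and every minimal homeomorphism `φ` of a Cantor
set `X`, there is a compact metric space `Y`, a minimal homeomorphism `ψ` of
`Y` and a factor map `π : (Y, ψ) → (X, φ)` whose fibers are each a single point
or homeomorphic to the `n`-cube `[0,1]ⁿ`, with both possibilities occurring. -/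
theorem cube_fiber_extension
    (n : ℕ) (hn : 1 ≤ n)
    {X : Type} [MetricSpace X] [CompactSpace X] [Nonempty X]
    [TotallyDisconnectedSpace X] [PerfectSpace X]
    (φ : X ≃ₜ X)
    (hmin : ∀ x : X, Dense (Set.range fun k : ℤ => (φ.toEquiv ^ k) x)) :
    ∃ (Y : Type) (_ : MetricSpace Y) (_ : CompactSpace Y)
      (ψ : Y ≃ₜ Y) (π : Y → X),
        Continuous π ∧ Function.Surjective π ∧
        (∀ y : Y, π (ψ y) = φ (π y)) ∧
        (∀ y : Y, Dense (Set.range fun k : ℤ => (ψ.toEquiv ^ k) y)) ∧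
        (∀ x : X, (∃ p : Y, π ⁻¹' {x} = {p}) ∨
          Nonempty ((π ⁻¹' {x}) ≃ₜ (Fin n → unitInterval))) ∧
        (∃ x : X, ∃ p : Y, π ⁻¹' {x} = {p}) ∧
        (∃ x : X, Nonempty ((π ⁻¹' {x}) ≃ₜ (Fin n → unitInterval))) := by
    classical
  have : Infinite X := by
    obtain ⟨x⟩ := ‹Nonempty X›
    exact infinite_univ_iff.1 (infinite_of_mem_nhds x univ_mem)
  obtain ⟨a⟩ := ‹Nonempty X›
  obtain ⟨f, hf, hosc⟩ := CantorExtension.exists_oscillating (C := Fin n → unitInterval) a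
  have hφ := CantorExtension.continuous_zpow φ
  have hinj := CantorExtension.zpow_apply_injective φ.toEquiv a (hmin a)
  have hD : Dense {x : X | ∀ k : ℤ, (φ.toEquiv ^ k) x ≠ a} := by
    have h : Dense (⋂ k : ℤ, (fun x => (φ.toEquiv ^ k) x) ⁻¹' {a}ᶜ) :=
      dense_iInter_of_isOpen (fun k => isOpen_compl_singleton.preimage (hφ k))
        (fun k => (dense_compl_singleton a).preimage (CantorExtension.isOpenMap_zpow φ k))
    refine h.mono fun x hx k => mem_iInter.1 hx k
  have hcpt : CompactSpace (CantorExtension.Ext φ.toEquiv a f) :=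
    CantorExtension.Ext.compactSpace hφ hf
  have hfiber : ∀ (x : X) (m : ℤ), (φ.toEquiv ^ m) x = a →
      Nonempty (((CantorExtension.Ext.proj : CantorExtension.Ext φ.toEquiv a f → X) ⁻¹' {x}) ≃ₜ
        (Fin n → unitInterval)) := by
    intro x m hm
    refine ⟨CantorExtension.Ext.fiberHomeomorph x m fun k => ⟨fun hk => ?_, fun hk => hk ▸ hm⟩⟩
    have hx : x = (φ.toEquiv ^ (-m)) a := by rw [zpow_neg, Equiv.Perm.eq_inv_iff_eq, hm]
    rw [hx, ← Equiv.Perm.mul_apply, ← zpow_add] at hk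
    have := @hinj (k + -m) 0 hk
    omega
  refine ⟨CantorExtension.Ext φ.toEquiv a f, TopologicalSpace.metrizableSpaceMetric _, hcpt,
    ⟨CantorExtension.Ext.lift, CantorExtension.Ext.continuous_lift φ.continuous,
      CantorExtension.Ext.continuous_lift_symm φ.symm.continuous⟩,
    CantorExtension.Ext.proj, CantorExtension.Ext.continuous_proj,
    fun x => ⟨CantorExtension.Ext.sec x, rfl⟩, CantorExtension.Ext.proj_lift,
    CantorExtension.Ext.dense_orbit hmin
      (CantorExtension.Ext.dense_avoiding hφ hinj hD hf hosc), fun x => ?_, ?_, a, hfiber a 0 rfl⟩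
  · by_cases hx : ∀ k : ℤ, (φ.toEquiv ^ k) x ≠ a
    · exact Or.inl ⟨_, CantorExtension.Ext.preimage_proj_of_forall_ne hx⟩
    · push Not at hx
      obtain ⟨m, hm⟩ := hx
      exact Or.inr (hfiber x m hm)
  · obtain ⟨x, -, hx⟩ := hD.inter_open_nonempty univ isOpen_univ ⟨a, mem_univ a⟩
    exact ⟨x, _, CantorExtension.Ext.preimage_proj_of_forall_ne hx⟩
end

section
/- Let X be a compact metric space, let f : X → X be a bijection, and let p ∈ X. Suppose f is continuous at every point of X except possibly p, and the inverse map f⁻¹ is continuous at every point of X except possibly f(p). Then f is a homeomorphism of X. -/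
open Filter Topology in
/-- A map into a compact space is continuous at `p` if it has a two-sided inverse into a
Hausdorff space which is continuous away from `f p`. -/
theorem ContinuousAt.of_inverse_of_compactSpace {X Y : Type*}
    [TopologicalSpace X] [T2Space X] [TopologicalSpace Y] [CompactSpace Y]
    {f : X → Y} {g : Y → X} {p : X} (hgf : Function.LeftInverse g f)
    (hfg : Function.RightInverse g f)
    (hg : ∀ y, y ≠ f p → ContinuousAt g y) : ContinuousAt f p := by
  refine (tendsto_iff_ultrafilter f (𝓝 p) (𝓝 (f p))).2 fun U hU => ?_
  have hy : Tendsto f U (𝓝 (U.map f).lim) := (U.map f).le_nhds_lim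
  by_cases h : (U.map f).lim = f p
  · rwa [h] at hy
  · have hlim : Tendsto (g ∘ f) U (𝓝 (g (U.map f).lim)) := (hg _ h).tendsto.comp hy
    rw [hgf.comp_eq_id] at hlim
    have hp : g (U.map f).lim = p := tendsto_nhds_unique hlim hU
    exact absurd (by rw [← hp, hfg]) h

/-- **Continuity at the last point for free.**
A bijection `f` of a compact metric space `X` which is continuous except
possibly at one point `p`, and whose inverse `g` is continuous except possibly
at `f p`, is a homeomorphism. -/
theorem isHomeomorph_of_continuousAt_compl_singleton
    {X : Type} [MetricSpace X] [CompactSpace X]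
    (f : X → X) (hf : Function.Bijective f) (p : X)
    (g : X → X) (hgf : Function.LeftInverse g f)
    (hfg : Function.RightInverse g f)
    (hcont : ∀ x : X, x ≠ p → ContinuousAt f x)
    (hcont' : ∀ y : X, y ≠ f p → ContinuousAt g y) :
    IsHomeomorph f := by
  refine isHomeomorph_iff_continuous_bijective.2 ⟨continuous_iff_continuousAt.2 fun x => ?_, hf⟩
  obtain rfl | hx := eq_or_ne x p
  · exact .of_inverse_of_compactSpace hgf hfg hcont'
  · exact hcont x hx
end

section
/- Let X̃ and X be compact metric spaces, let φ̃ : X̃ → X̃ and φ : X → X be homeomorphisms, and let π : X̃ → X be a continuous surjection with π ∘ φ̃ = φ ∘ π. Let B = {x ∈ X : π⁻¹{x} contains more than one point}, and suppose that ν(B) = 0 for every φ-invariant Borel probability measure ν on X. Then the pushforward map μ ↦ π_*μ is a bijection from the set of φ̃-invariant Borel probability measures on X̃ onto the set of φ-invariant Borel probability measures on X. -/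
open MeasureTheory

/-- The set of points with non-singleton fiber under a continuous map from a compact metric space
is Borel (in fact an `F_σ`). -/
theorem measurableSet_setOf_nontrivial_fiber
    {Y X : Type*} [MetricSpace Y] [CompactSpace Y]
    [TopologicalSpace X] [T2Space X] [MeasurableSpace X] [BorelSpace X]
    {π : Y → X} (hπ : Continuous π) :
    MeasurableSet {x : X | (π ⁻¹' {x}).Nontrivial} := by
  have key : {x : X | (π ⁻¹' {x}).Nontrivial} =
      ⋃ n : ℕ, (fun p : Y × Y => π p.1) ''
        {p | π p.1 = π p.2 ∧ 1 / ((n : ℝ) + 1) ≤ dist p.1 p.2} := by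
    ext x
    simp only [Set.mem_ofPred_eq, Set.mem_iUnion, Set.mem_image, Prod.exists]
    constructor
    · rintro ⟨a, ha, b, hb, hab⟩
      obtain ⟨n, hn⟩ := exists_nat_one_div_lt (dist_pos.2 hab)
      exact ⟨n, a, b, ⟨ha.trans hb.symm, hn.le⟩, ha⟩
    · rintro ⟨n, a, b, ⟨hab, hn⟩, ha⟩
      exact ⟨a, ha, b, hab.symm.trans ha, dist_pos.1 (Nat.one_div_pos_of_nat.trans_le hn)⟩
  rw [key]
  refine MeasurableSet.iUnion fun n => ?_
  have hclosed : IsClosed {p : Y × Y | π p.1 = π p.2 ∧ 1 / ((n : ℝ) + 1) ≤ dist p.1 p.2} :=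
    (isClosed_eq (hπ.comp continuous_fst) (hπ.comp continuous_snd)).inter
      (isClosed_le continuous_const continuous_dist)
  exact (hclosed.isCompact.image (by fun_prop)).measurableSet

/-- A continuous map from a nonempty compact metric space has a Borel left inverse off the
preimage of the set of points with non-singleton fiber. -/
theorem exists_measurable_leftInverse_off_nontrivial_fiber
    {Y X : Type*} [MetricSpace Y] [CompactSpace Y] [Nonempty Y]
    [MeasurableSpace Y] [BorelSpace Y]
    [MetricSpace X] [MeasurableSpace X] [BorelSpace X]
    {π : Y → X} (hπ : Continuous π) :
    ∃ g : X → Y, Measurable g ∧ ∀ y, ¬ (π ⁻¹' {π y}).Nontrivial → g (π y) = y := by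
  set G : Set Y := π ⁻¹' {x : X | (π ⁻¹' {x}).Nontrivial}ᶜ
  have hG : MeasurableSet G := hπ.measurable (measurableSet_setOf_nontrivial_fiber hπ).compl
  have hinj : Set.InjOn π G := fun a ha b _ hab =>
    Set.not_nontrivial_iff.1 ha rfl hab.symm
  obtain ⟨g, hg, hgeq⟩ := (hπ.continuousOn.measurableEmbedding hG hinj).exists_measurable_extend
    measurable_subtype_coe fun _ => inferInstance
  exact ⟨g, hg, fun y hy => congrFun hgeq ⟨y, hy⟩⟩

/-- **Measure-lifting principle for almost one-to-one factor maps.**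
Let `π : (Y, ψ) → (X, φ)` be a factor map between compact metric dynamical
systems. If the set of points of `X` with non-singleton fiber is null for every
`φ`-invariant Borel probability measure, then `μ ↦ π_*μ` is a bijection from
the `ψ`-invariant Borel probability measures on `Y` onto the `φ`-invariant
Borel probability measures on `X`. -/
theorem pushforward_bijOn_invariant_measures
    {Y X : Type} [MetricSpace Y] [CompactSpace Y]
    [MeasurableSpace Y] [BorelSpace Y]
    [MetricSpace X] [CompactSpace X] [MeasurableSpace X] [BorelSpace X]
    (ψ : Y ≃ₜ Y) (φ : X ≃ₜ X) (π : Y → X)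
    (hπc : Continuous π) (hπs : Function.Surjective π)
    (hcomm : ∀ y : Y, π (ψ y) = φ (π y))
    (hnull : ∀ ν : Measure X, IsProbabilityMeasure ν → ν.map φ = ν →
      ν {x : X | (π ⁻¹' {x}).Nontrivial} = 0) :
    Set.BijOn (fun μ : Measure Y => μ.map π)
      {μ : Measure Y | IsProbabilityMeasure μ ∧ μ.map ψ = μ}
      {ν : Measure X | IsProbabilityMeasure ν ∧ ν.map φ = ν} := by
  set B : Set X := {x : X | (π ⁻¹' {x}).Nontrivial}
  have hπm : Measurable π := hπc.measurable
  have hψm : Measurable ψ := ψ.continuous.measurable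
  have hφm : Measurable φ := φ.continuous.measurable
  have hB : MeasurableSet B := measurableSet_setOf_nontrivial_fiber hπc
  have map_comm (μ : Measure Y) : (μ.map ψ).map π = (μ.map π).map φ := by
    rw [Measure.map_map hπm hψm, Measure.map_map hφm hπm]
    exact congrArg μ.map (funext hcomm)
  have maps : Set.MapsTo (fun μ : Measure Y => μ.map π)
      {μ : Measure Y | IsProbabilityMeasure μ ∧ μ.map ψ = μ}
      {ν : Measure X | IsProbabilityMeasure ν ∧ ν.map φ = ν} := by
    rintro μ ⟨hμ, hinv⟩
    exact ⟨Measure.isProbabilityMeasure_map hπm.aemeasurable, by rw [← map_comm, hinv]⟩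
  rcases isEmpty_or_nonempty Y with hY | hY
  · have : IsEmpty X := hπs.isEmpty
    refine ⟨maps, fun _ _ _ _ _ => Subsingleton.elim _ _, ?_⟩
    rintro ν ⟨hν, -⟩
    exact absurd (Measure.eq_zero_of_isEmpty ν) (IsProbabilityMeasure.ne_zero ν)
  obtain ⟨g, hg, hgπ⟩ := exists_measurable_leftInverse_off_nontrivial_fiber hπc
  have map_map_eq (μ : Measure Y) (h : μ.map π B = 0) : (μ.map π).map g = μ := by
    rw [Measure.map_apply hπm hB] at h
    rw [Measure.map_map hg hπm]
    have hae : g ∘ π =ᵐ[μ] id := by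
      filter_upwards [measure_eq_zero_iff_ae_notMem.1 h] with y hy using hgπ y hy
    rw [Measure.map_congr hae, Measure.map_id]
  refine ⟨maps, ?_, ?_⟩
  · intro μ₁ h₁ μ₂ h₂ h
    have null {μ : Measure Y} (hμ : IsProbabilityMeasure μ ∧ μ.map ψ = μ) : μ.map π B = 0 :=
      hnull _ (maps hμ).1 (maps hμ).2
    rw [← map_map_eq μ₁ (null h₁), ← map_map_eq μ₂ (null h₂)]
    exact congrArg (Measure.map g) h
  · rintro ν ⟨hν, hinv⟩
    have hνB : ν B = 0 := hnull ν hν hinv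
    have hπg : (ν.map g).map π = ν := by
      rw [Measure.map_map hπm hg]
      have hae : π ∘ g =ᵐ[ν] id := by
        filter_upwards [measure_eq_zero_iff_ae_notMem.1 hνB] with x hx
        obtain ⟨y, rfl⟩ := hπs x
        exact congrArg π (hgπ y hx)
      rw [Measure.map_congr hae, Measure.map_id]
    have hψπ : ((ν.map g).map ψ).map π = ν := by rw [map_comm, hπg, hinv]
    refine ⟨ν.map g, ⟨Measure.isProbabilityMeasure_map hg.aemeasurable, ?_⟩, hπg⟩
    rw [← map_map_eq ((ν.map g).map ψ) (by rwa [hψπ]), hψπ]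
end
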